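/- arXiv:2309.15470 — 4 statements merged into one kernel-verified Lean document; each statement's English description precedes it below -/
import Mathlib

section
/- For all nonnegative integers s and r, the identity C(m,s)·C(m,r) = Σ_{k=0}^{s} C(s,k)·C(r+k,s)·C(m,r+k) holds as an equality of polynomials in ℚ[m] (equivalently, for every nonnegative integer m). -/
/-- For all nonnegative integers `s` and `r`, the identity
`C(m,s)·C(m,r) = Σ_{k=0}^{s} C(s,k)·C(r+k,s)·C(m,r+k)`
holds for every nonnegative integer `m`. -/
theorem binomial_product_expansion (s r m : ℕ) :
    m.choose s * m.choose r =
      ∑ k ∈ Finset.range (s + 1),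
        s.choose k * (r + k).choose s * m.choose (r + k) := by
  obtain hmr | hrm := lt_or_ge m r
  · rw [Nat.choose_eq_zero_of_lt hmr, mul_zero]
    refine (Finset.sum_eq_zero fun k _ => ?_).symm
    rw [Nat.choose_eq_zero_of_lt (show m < r + k by omega), mul_zero]
  · obtain ⟨n, rfl⟩ := Nat.exists_eq_add_of_le hrm
    conv_lhs =>
      rw [add_comm r n, Nat.add_choose_eq, Finset.Nat.sum_antidiagonal_eq_sum_range_succ_mk,
        Finset.sum_mul, add_comm n r]
    refine Finset.sum_congr rfl fun k hk => ?_
    have hks : k ≤ s := Nat.lt_succ_iff.mp (Finset.mem_range.mp hk)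
    have h₁ := Nat.choose_mul (n := r + k) hks
    have h₂ := Nat.choose_mul (n := r + n) (Nat.le_add_right r k)
    rw [Nat.add_sub_cancel] at h₁
    rw [Nat.add_sub_cancel_left, Nat.add_sub_cancel_left, Nat.choose_symm_add] at h₂
    calc n.choose k * r.choose (s - k) * (r + n).choose r
        = (r + n).choose r * n.choose k * r.choose (s - k) := by ring
      _ = (r + n).choose (r + k) * ((r + k).choose k * r.choose (s - k)) := by
        rw [← h₂, mul_assoc]
      _ = s.choose k * (r + k).choose s * (r + n).choose (r + k) := by
        rw [← h₁]; ring
end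

section
/- For all nonnegative integers s and r, the identity C(m,s)·C(m,r) = Σ_{k=max(s,r)}^{s+r} C(s,k-r)·C(k,s)·C(m,k) holds as an equality of polynomials in ℚ[m] (equivalently, for every nonnegative integer m). -/
/-- For all nonnegative integers `s` and `r`, the identity
`C(m,s)·C(m,r) = Σ_{k=max(s,r)}^{s+r} C(s,k-r)·C(k,s)·C(m,k)`
holds for every nonnegative integer `m`. -/
theorem binomial_product_expansion' (s r m : ℕ) :
    m.choose s * m.choose r =
      ∑ k ∈ Finset.Icc (max s r) (s + r),
        s.choose (k - r) * k.choose s * m.choose k := by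
  obtain hm | hm := lt_or_ge m s
  · rw [Nat.choose_eq_zero_of_lt hm, zero_mul, eq_comm]
    refine Finset.sum_eq_zero fun k hk => ?_
    rw [Finset.mem_Icc] at hk
    rw [Nat.choose_eq_zero_of_lt (show m < k by omega), mul_zero]
  · have vandermonde : m.choose r =
        ∑ k ∈ Finset.Icc (max s r) (s + r), s.choose (s + r - k) * (m - s).choose (k - s) := by
      conv_lhs => rw [← Nat.add_sub_of_le hm, Nat.add_choose_eq]
      symm
      refine Finset.sum_of_injOn (fun k => (s + r - k, k - s)) ?_ ?_ ?_ fun _ _ => rfl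
      · intro a ha b hb hab
        simp only [Finset.coe_Icc, Set.mem_Icc, Prod.mk.injEq] at ha hb hab
        omega
      · intro k hk
        simp only [Finset.coe_Icc, Set.mem_Icc] at hk
        simp only [Finset.mem_coe, Finset.HasAntidiagonal.mem_antidiagonal]
        omega
      · rintro ⟨i, j⟩ hij hnot
        rw [Finset.HasAntidiagonal.mem_antidiagonal] at hij
        dsimp only at hij ⊢
        obtain hi | hi := lt_or_ge s i
        · rw [Nat.choose_eq_zero_of_lt hi, zero_mul]
        · refine absurd ⟨s + j, ?_, ?_⟩ hnot
          · simp only [Finset.coe_Icc, Set.mem_Icc]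
            omega
          · simp only [Prod.mk.injEq]
            omega
    rw [vandermonde, Finset.mul_sum]
    refine Finset.sum_congr rfl fun k hk => ?_
    rw [Finset.mem_Icc] at hk
    have hsymm : s.choose (s + r - k) = s.choose (k - r) :=
      Nat.choose_symm_of_eq_add (by omega)
    have hmul := Nat.choose_mul (n := m) (show s ≤ k by omega)
    rw [hsymm, mul_left_comm, ← hmul, mul_assoc, mul_comm (k.choose s)]
end

section
/- For all nonnegative integers a, s, t, u, the polynomial f(m,n) = C(u·C(m,s)·C(n,t), a) (the composition of the binomial coefficient polynomial C(X,a) with the polynomial u·C(m,s)·C(n,t)) can be written as a finite sum Σ_{0 ≤ k ≤ sa, 0 ≤ l ≤ ta} α_{k,l} · C(m,k) · C(n,l) with all coefficients α_{k,l} nonnegative integers. -/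
/-- The one-variable binomial coefficient polynomial
`C(X,k) = X(X-1)⋯(X-k+1)/k! ∈ ℚ[X]`. -/
noncomputable def binPoly (k : ℕ) : Polynomial ℚ :=
  Polynomial.C ((k.factorial : ℚ)⁻¹) * descPochhammer ℚ k

/-- The two-variable polynomial `C(m,k)·C(n,l) ∈ ℚ[m,n]`. -/
noncomputable def binMv (k l : ℕ) : MvPolynomial (Fin 2) ℚ :=
  Polynomial.aeval (MvPolynomial.X 0) (binPoly k) *
    Polynomial.aeval (MvPolynomial.X 1) (binPoly l)

open Finset Polynomial

open scoped fwdDiff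

/-- `f : M → ℕ` is absolutely monotone to order `n` along the steps in `H` if every forward
difference of `f` of order at most `n`, with steps in `H`, is again valued in `ℕ`. -/
def AbsMonotone {M : Type*} [Add M] (H : Set M) : ℕ → (M → ℕ) → Prop
  | 0, _ => True
  | n + 1, f => ∀ h ∈ H, ∃ g, AbsMonotone H n g ∧ ∀ x, f (x + h) = f x + g x

namespace AbsMonotone

section Add

variable {M : Type*} [Add M] {H : Set M}

theorem of_succ {n : ℕ} {f : M → ℕ} (hf : AbsMonotone H (n + 1) f) : AbsMonotone H n f := by
  induction n generalizing f with
  | zero => trivial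
  | succ n ih =>
    intro h hh
    obtain ⟨g, hg, hfg⟩ := hf h hh
    exact ⟨g, ih hg, hfg⟩

theorem const (n c : ℕ) : AbsMonotone H n fun _ ↦ c := by
  induction n generalizing c with
  | zero => trivial
  | succ n ih => exact fun h _ ↦ ⟨fun _ ↦ 0, ih 0, fun _ ↦ rfl⟩

theorem add {n : ℕ} {f g : M → ℕ} (hf : AbsMonotone H n f) (hg : AbsMonotone H n g) :
    AbsMonotone H n fun x ↦ f x + g x := by
  induction n generalizing f g with
  | zero => trivial
  | succ n ih =>
    intro h hh
    obtain ⟨f', hf', hff'⟩ := hf h hh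
    obtain ⟨g', hg', hgg'⟩ := hg h hh
    exact ⟨_, ih hf' hg', fun x ↦ by simp only [hff', hgg']; ring⟩

theorem sum {n : ℕ} {ι : Type*} (s : Finset ι) {f : ι → M → ℕ}
    (hf : ∀ i ∈ s, AbsMonotone H n (f i)) : AbsMonotone H n fun x ↦ ∑ i ∈ s, f i x := by
  classical
  induction s using Finset.induction_on with
  | empty => simpa using const n 0
  | insert i s hi ih =>
    simp only [Finset.sum_insert hi]
    exact (hf i (mem_insert_self i s)).add (ih fun j hj ↦ hf j (mem_insert_of_mem hj))

theorem mul {n : ℕ} {f g : M → ℕ} (hf : AbsMonotone H n f) (hg : AbsMonotone H n g) :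
    AbsMonotone H n fun x ↦ f x * g x := by
  induction n generalizing f g with
  | zero => trivial
  | succ n ih =>
    intro h hh
    obtain ⟨f', hf', hff'⟩ := hf h hh
    obtain ⟨g', hg', hgg'⟩ := hg h hh
    exact ⟨_, ((ih hf.of_succ hg').add (ih hf' hg.of_succ)).add (ih hf' hg'),
      fun x ↦ by simp only [hff', hgg']; ring⟩

theorem choose {n : ℕ} {f : M → ℕ} (hf : AbsMonotone H n f) (a : ℕ) :
    AbsMonotone H n fun x ↦ (f x).choose a := by
  induction n generalizing f a with
  | zero => trivial
  | succ n ih =>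
    intro h hh
    obtain ⟨g, hg, hfg⟩ := hf h hh
    refine ⟨fun x ↦ ∑ i ∈ range a, (f x).choose i * (g x).choose (a - i),
      sum _ fun i _ ↦ (ih hf.of_succ i).mul (ih hg (a - i)), fun x ↦ ?_⟩
    simp only [hfg]
    rw [Nat.add_choose_eq,
      Finset.Nat.sum_antidiagonal_eq_sum_range_succ fun i j ↦ (f x).choose i * (g x).choose j,
      sum_range_succ, add_comm]
    simp

end Add

theorem of_map_add {M : Type*} [AddMonoid M] {H : Set M} (n : ℕ) (φ : M →+ ℕ) :
    AbsMonotone H n φ := by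
  cases n with
  | zero => trivial
  | succ n => exact fun h _ ↦ ⟨fun _ ↦ φ h, const n _, fun x ↦ map_add φ x h⟩

theorem exists_fwdDiff_iter_eq {M : Type*} [AddCommMonoid M] {H : Set M} {R : Type*}
    [AddCommGroupWithOne R] {n k : ℕ} {f : M → ℕ} {h : M} (hh : h ∈ H)
    (hf : AbsMonotone H (k + n) f) :
    ∃ g : M → ℕ, AbsMonotone H n g ∧ (Δ_[h])^[k] (fun x ↦ (f x : R)) = fun x ↦ (g x : R) := by
  induction k generalizing f with
  | zero => exact ⟨f, by simpa using hf, rfl⟩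
  | succ k ih =>
    rw [Nat.succ_add_eq_add_succ] at hf
    obtain ⟨g, hg, hfg⟩ := hf h hh
    obtain ⟨g', hg', hgg'⟩ := ih hg
    refine ⟨g', hg', ?_⟩
    rw [Function.iterate_succ_apply, ← hgg']
    congr 1
    ext x
    simp [fwdDiff, hfg]

end AbsMonotone

theorem fwdDiff_comm {M G : Type*} [AddCommMonoid M] [AddCommGroup G] (h h' : M) :
    Function.Commute (fwdDiff h : (M → G) → M → G) (fwdDiff h') := by
  intro f
  ext x
  simp only [fwdDiff, add_right_comm x h h']
  abel

/-- Iterated forward differences of a function vanish beyond its degree on an arithmetic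
progression. -/
theorem fwdDiff_iter_eq_zero_of_eq_eval {M R : Type*} [AddCommMonoid M] [CommRing R] {f : M → R}
    {h y : M} {p : R[X]} {c : R} {n : ℕ} (hf : ∀ k : ℕ, f (y + k • h) = p.eval (c + k))
    (hp : p.natDegree < n) : (Δ_[h])^[n] f y = 0 := by
  have := congrFun (Polynomial.fwdDiff_iter_eq_zero_of_degree_lt hp) c
  rw [fwdDiff_iter_eq_sum_shift] at this ⊢
  simpa [hf] using this

/-- The **Gregory-Newton formula** in two variables. -/
theorem eq_sum_choose_smul_fwdDiff_iter {G : Type*} [AddCommGroup G] (f : ℕ × ℕ → G) (m n : ℕ) :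
    f (m, n) = ∑ k ∈ range (m + 1), ∑ l ∈ range (n + 1),
      (m.choose k * n.choose l) • (Δ_[((0, 1) : ℕ × ℕ)])^[l] ((Δ_[((1, 0) : ℕ × ℕ)])^[k] f) (0, 0) := by
  have h₁ := shift_eq_sum_fwdDiff_iter ((1, 0) : ℕ × ℕ) f m (0, n)
  have h₂ (k : ℕ) :=
    shift_eq_sum_fwdDiff_iter ((0, 1) : ℕ × ℕ) ((Δ_[((1, 0) : ℕ × ℕ)])^[k] f) n (0, 0)
  simp only [Prod.smul_mk, smul_eq_mul, mul_one, mul_zero, Prod.mk_add_mk, zero_add,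
    add_zero] at h₁ h₂
  simp only [h₁, h₂, smul_sum, mul_smul]

theorem sum_range_eq_sum_range_of_eq_zero {G : Type*} [AddCommMonoid G] {f : ℕ → G} {a b : ℕ}
    (ha : ∀ k, a ≤ k → f k = 0) (hb : ∀ k, b ≤ k → f k = 0) :
    ∑ k ∈ range a, f k = ∑ k ∈ range b, f k := by
  rw [← eventually_constant_sum ha (le_max_left a b),
    ← eventually_constant_sum hb (le_max_right a b)]

theorem eval_binPoly_natCast (k n : ℕ) : (binPoly k).eval (n : ℚ) = n.choose k := by
  rw [binPoly, eval_mul, eval_C, descPochhammer_eval_eq_descFactorial,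
    Nat.descFactorial_eq_factorial_mul_choose, Nat.cast_mul,
    inv_mul_cancel_left₀ (Nat.cast_ne_zero.2 k.factorial_ne_zero)]

theorem natDegree_binPoly_le (k : ℕ) : (binPoly k).natDegree ≤ k :=
  (natDegree_C_mul_le _ _).trans (descPochhammer_natDegree ℚ k).le

theorem eval_aeval_binPoly {σ : Type*} (x : σ → ℚ) (p : MvPolynomial σ ℚ) (a : ℕ) :
    MvPolynomial.eval x (Polynomial.aeval p (binPoly a)) =
      (binPoly a).eval (MvPolynomial.eval x p) := by
  simp only [← MvPolynomial.coe_aeval_eq_eval, RingHom.coe_coe]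
  rw [← Polynomial.aeval_algHom_apply, Polynomial.coe_aeval_eq_eval]

theorem eval_binMv_natCast (k l : ℕ) (x : Fin 2 → ℕ) :
    MvPolynomial.eval (fun i ↦ (x i : ℚ)) (binMv k l) = (x 0).choose k * (x 1).choose l := by
  simp only [binMv, map_mul, eval_aeval_binPoly, MvPolynomial.eval_X, eval_binPoly_natCast]

/-- The polynomial `C(c·C(X,s), a)`. -/
noncomputable def binPolyComp (c : ℚ) (s a : ℕ) : ℚ[X] :=
  (binPoly a).comp (C c * binPoly s)

theorem eval_binPolyComp_natCast (c s a n : ℕ) :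
    (binPolyComp c s a).eval (n : ℚ) = (c * n.choose s).choose a := by
  rw [binPolyComp, eval_comp, eval_mul, eval_C, eval_binPoly_natCast, ← Nat.cast_mul,
    eval_binPoly_natCast]

theorem natDegree_binPolyComp_le (c : ℚ) (s a : ℕ) : (binPolyComp c s a).natDegree ≤ s * a :=
  natDegree_comp_le.trans <| mul_comm s a ▸ Nat.mul_le_mul (natDegree_binPoly_le a)
    ((natDegree_C_mul_le _ _).trans (natDegree_binPoly_le s))

/-- For all nonnegative integers `a, s, t, u`, the polynomial
`C(u·C(m,s)·C(n,t), a)` (the composition of `C(X,a)` with `u·C(m,s)·C(n,t)`)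
can be written as `Σ_{0 ≤ k ≤ sa, 0 ≤ l ≤ ta} α_{k,l}·C(m,k)·C(n,l)` with all
`α_{k,l}` nonnegative integers. -/
theorem choose_of_monomial_PBC_is_nonneg_PBC (a s t u : ℕ) :
    ∃ α : ℕ → ℕ → ℕ,
      Polynomial.aeval ((u : MvPolynomial (Fin 2) ℚ) * binMv s t) (binPoly a) =
        ∑ k ∈ Finset.range (s * a + 1), ∑ l ∈ Finset.range (t * a + 1),
          MvPolynomial.C ((α k l : ℚ)) * binMv k l := by
  let F : ℕ × ℕ → ℕ := fun x ↦ (u * x.1.choose s * x.2.choose t).choose a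
  let H : Set (ℕ × ℕ) := {(1, 0), (0, 1)}
  have hF (n : ℕ) : AbsMonotone H n F :=
    (((AbsMonotone.const n u).mul ((AbsMonotone.of_map_add n (AddMonoidHom.fst ℕ ℕ)).choose s)).mul
      ((AbsMonotone.of_map_add n (AddMonoidHom.snd ℕ ℕ)).choose t)).choose a
  let f : ℕ × ℕ → ℚ := fun x ↦ F x
  have hα (k l : ℕ) : ∃ c : ℕ,
      (Δ_[((0, 1) : ℕ × ℕ)])^[l] ((Δ_[((1, 0) : ℕ × ℕ)])^[k] f) (0, 0) = c := by
    obtain ⟨g, hg, hfg⟩ := (hF (k + l)).exists_fwdDiff_iter_eq (R := ℚ)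
      (show ((1, 0) : ℕ × ℕ) ∈ H by simp [H])
    obtain ⟨g', -, hgg'⟩ := AbsMonotone.exists_fwdDiff_iter_eq (R := ℚ) (n := 0)
      (show ((0, 1) : ℕ × ℕ) ∈ H by simp [H]) hg
    exact ⟨g' (0, 0), by rw [hfg, hgg']⟩
  choose α hα using hα
  have hk (k l : ℕ) (hk : s * a + 1 ≤ k) : α k l = 0 := by
    have h0 : (Δ_[((1, 0) : ℕ × ℕ)])^[k] f = fun _ ↦ 0 := by
      ext ⟨m, n⟩
      refine fwdDiff_iter_eq_zero_of_eq_eval (c := (m : ℚ))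
        (p := binPolyComp ((u * n.choose t : ℕ) : ℚ) s a) (fun j ↦ ?_)
        (Nat.lt_of_le_of_lt (natDegree_binPolyComp_le _ s a) hk)
      rw [← Nat.cast_add, eval_binPolyComp_natCast]
      simp [f, F, mul_right_comm]
    have := hα k l
    rw [h0, fwdDiff_iter_eq_sum_shift] at this
    simpa using this.symm
  have hl (k l : ℕ) (hl : t * a + 1 ≤ l) : α k l = 0 := by
    have h0 : (Δ_[((0, 1) : ℕ × ℕ)])^[l] f = fun _ ↦ 0 := by
      ext ⟨m, n⟩
      refine fwdDiff_iter_eq_zero_of_eq_eval (c := (n : ℚ))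
        (p := binPolyComp ((u * m.choose s : ℕ) : ℚ) t a) (fun j ↦ ?_)
        (Nat.lt_of_le_of_lt (natDegree_binPolyComp_le _ t a) hl)
      rw [← Nat.cast_add, eval_binPolyComp_natCast]
      simp [f, F]
    have := hα k l
    rw [(fwdDiff_comm (0, 1) (1, 0)).iterate_iterate l k f, h0, fwdDiff_iter_eq_sum_shift] at this
    simpa using this.symm
  refine ⟨α, MvPolynomial.funext_set (fun _ ↦ Set.range ((↑) : ℕ → ℚ))
    (fun _ ↦ Set.infinite_range_of_injective Nat.cast_injective) fun y hy ↦ ?_⟩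
  choose x hx using fun i ↦ hy i (Set.mem_univ i)
  obtain rfl : (fun i ↦ (x i : ℚ)) = y := funext hx
  have hnewton := eq_sum_choose_smul_fwdDiff_iter f (x 0) (x 1)
  simp only [hα, nsmul_eq_mul, Nat.cast_mul] at hnewton
  simp only [eval_aeval_binPoly, map_mul, map_natCast, map_sum, eval_binMv_natCast]
  rw [← mul_assoc, ← Nat.cast_mul, ← Nat.cast_mul, eval_binPoly_natCast]
  refine hnewton.trans ?_
  rw [sum_range_eq_sum_range_of_eq_zero (b := s * a + 1)
    (fun k h ↦ by simp [Nat.choose_eq_zero_of_lt h]) (fun k h ↦ by simp [hk k _ h])]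
  refine sum_congr rfl fun k _ ↦ ?_
  rw [sum_range_eq_sum_range_of_eq_zero (b := t * a + 1)
    (fun l h ↦ by simp [Nat.choose_eq_zero_of_lt h]) (fun l h ↦ by simp [hl k l h])]
  exact sum_congr rfl fun l _ ↦ mul_comm _ _
end

section
/- Let a be a positive integer and let k be an integer with ⌈a/2⌉ ≤ k ≤ a. Then Σ_{x=a-k}^{⌊a/2⌋} (a - 2x)·C(a-x, k-x)·C(k, a-x) = ⌈(2k-a)/2⌉ · C(2k-a, ⌈(2k-a)/2⌉) · C(k, 2k-a). -/
theorem sum_range_sub_two_mul_mul_choose (m n : ℕ) (h : 2 * n ≤ m + 2) :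
    ∑ j ∈ Finset.range n, (m - 2 * j) * m.choose j = n * m.choose n := by
  induction n with
  | zero => simp
  | succ n ih =>
    rw [Finset.sum_range_succ, ih (by omega), ← add_mul, mul_comm (n + 1),
      Nat.choose_succ_right_eq, mul_comm (m.choose n)]
    congr 1
    omega

theorem half_succ_mul_choose (m : ℕ) :
    (m / 2 + 1) * m.choose (m / 2 + 1) = (m + 1) / 2 * m.choose ((m + 1) / 2) := by
  obtain ⟨t, rfl | rfl⟩ := m.even_or_odd'
  · rw [mul_comm, Nat.choose_succ_right_eq, mul_comm,
      show 2 * t - 2 * t / 2 = t by omega, show 2 * t / 2 = t by omega,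
      show (2 * t + 1) / 2 = t by omega]
  · rw [show (2 * t + 1) / 2 + 1 = (2 * t + 1 + 1) / 2 by omega]

/-- Let `a` be a positive integer and `k` an integer with `⌈a/2⌉ ≤ k ≤ a`. Then
`Σ_{x=a-k}^{⌊a/2⌋} (a-2x)·C(a-x,k-x)·C(k,a-x)
  = ⌈(2k-a)/2⌉·C(2k-a,⌈(2k-a)/2⌉)·C(k,2k-a)`.
(Here `⌈y/2⌉ = (y+1)/2` in natural-number division.) -/
theorem sum_coeff_b_eq_two_n (a k : ℕ) (ha : 0 < a)
    (hk1 : (a + 1) / 2 ≤ k) (hk2 : k ≤ a) :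
    ∑ x ∈ Finset.Icc (a - k) (a / 2),
        (a - 2 * x) * (a - x).choose (k - x) * k.choose (a - x) =
      (2 * k - a + 1) / 2 * (2 * k - a).choose ((2 * k - a + 1) / 2) * k.choose (2 * k - a) := by
  obtain ⟨d, rfl⟩ := Nat.exists_eq_add_of_le hk2
  obtain ⟨m, rfl⟩ := Nat.exists_eq_add_of_le (show d ≤ k by omega)
  rw [show 2 * (d + m) - (d + m + d) = m by omega, ← half_succ_mul_choose,
    ← sum_range_sub_two_mul_mul_choose m (m / 2 + 1) (by omega), Finset.sum_mul,
    ← Finset.Ico_add_one_right_eq_Icc, Finset.sum_Ico_eq_sum_range,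
    show (d + m + d) / 2 + 1 - (d + m + d - (d + m)) = m / 2 + 1 by omega]
  refine Finset.sum_congr rfl fun j hj => ?_
  have hj : j ≤ m / 2 := by simpa [Nat.lt_succ_iff] using hj
  have hjm : j ≤ m := by omega
  rw [show d + m + d - (d + m) + j = d + j by omega,
    show d + m + d - 2 * (d + j) = m - 2 * j by omega,
    show d + m + d - (d + j) = d + m - j by omega,
    show d + m - (d + j) = m - j by omega,
    Nat.choose_symm (show j ≤ d + m by omega), mul_assoc, mul_assoc,
    mul_comm (m.choose j), Nat.choose_mul hjm, mul_comm ((d + m).choose j)]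
end
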